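/- Let p_i = B/(4 i^α) (with the truncation convention) for some B > 0 and 0 < α < 1. Then as m → ∞, D(m,∞) = (1 + o(1)) · m^α / B, and the probability p(m,m+1,∞) that the chain started at m+1 ever hits m satisfies 1 − p(m,m+1,∞) = (1 + o(1)) · B / m^α. -/

import Mathlib

open MeasureTheory Filter Finset
open scoped ENNReal NNReal Topology

noncomputable section

namespace NNRW

/-- Probability of a step to the right from site `i`: `E 0 = 1`, `E i = 1/2 + p i` for `i ≥ 1`. -/
def E (p : ℕ → ℝ) (i : ℕ) : ℝ := if i = 0 then 1 else 1 / 2 + p i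

/-- One-step transition probability of the nearest-neighbour walk, from `i` to `j`. -/
def step (p : ℕ → ℝ) (i j : ℕ) : ℝ :=
  if j = i + 1 then E p i else if j + 1 = i then 1 - E p i else 0

/-- `X` is (distributed as) the nearest-neighbour Markov chain with parameters `p`, started
at `b`, under the probability measure `P`: `X 0 = b` and the finite-dimensional
distributions are the products of the one-step transition probabilities. -/
def IsNNWalk {Ω : Type*} [MeasurableSpace Ω] (P : Measure Ω)
    (X : ℕ → Ω → ℕ) (p : ℕ → ℝ) (b : ℕ) : Prop :=
  (∀ ω, X 0 ω = b) ∧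
    ∀ (n : ℕ) (u : ℕ → ℕ), u 0 = b →
      P {ω | ∀ k ≤ n, X k ω = u k} =
        ENNReal.ofReal (∏ k ∈ Finset.range n, step p (u k) (u (k + 1)))

/-- `U i = (1/2 - p i)/(1/2 + p i)`. -/
def U (p : ℕ → ℝ) (i : ℕ) : ℝ := (1 / 2 - p i) / (1 / 2 + p i)

/-- `D(m,n)` for finite `m ≤ n`. -/
def Dfin (p : ℕ → ℝ) (m n : ℕ) : ℝ :=
  if n = m then 0
  else 1 + ∑ j ∈ Finset.Icc 1 (n - m - 1), ∏ i ∈ Finset.Icc 1 j, U p (m + i)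

/-- `D(m,∞) = lim_{n → ∞} D(m,n) ∈ (0,∞]`. -/
def Dinf (p : ℕ → ℝ) (m : ℕ) : ℝ≥0∞ :=
  1 + ∑' j : ℕ, ENNReal.ofReal (∏ i ∈ Finset.Icc 1 (j + 1), U p (m + i))

/-- Event: the walk visits `a` (strictly) before it ever visits `c`. -/
def hitsBefore {Ω : Type*} (X : ℕ → Ω → ℕ) (a c : ℕ) : Set Ω :=
  {ω | ∃ n, X n ω = a ∧ ∀ k < n, X k ω ≠ c}

/-- Event: the walk ever visits `a`. -/
def hits {Ω : Type*} (X : ℕ → Ω → ℕ) (a : ℕ) : Set Ω := {ω | ∃ n, X n ω = a}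

/-- Total local time `ξ(x,∞)` at site `x` (equal to `∞` if there are infinitely many
visits). -/
def localTime {Ω : Type*} (X : ℕ → Ω → ℕ) (x : ℕ) (ω : Ω) : ℝ≥0∞ :=
  ∑' k : ℕ, Set.indicator {k | X k ω = x} (fun _ => (1 : ℝ≥0∞)) k

/-- Total number of upcrossings `ξ(x,∞,↑)` at site `x`. -/
def upcross {Ω : Type*} (X : ℕ → Ω → ℕ) (x : ℕ) (ω : Ω) : ℝ≥0∞ :=
  ∑' k : ℕ, Set.indicator {k | X k ω = x ∧ X (k + 1) ω = x + 1} (fun _ => (1 : ℝ≥0∞)) k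

/-- Iterated logarithm: `iterLog 0 x = x`, `iterLog (k+1) x = log (iterLog k x)`. -/
def iterLog : ℕ → ℝ → ℝ
  | 0, x => x
  | k + 1, x => Real.log (iterLog k x)

/-- `λ(k,x)`: `lam 0 x = 1`, `lam (k+1) x = lam k x * log_k x`. -/
def lam : ℕ → ℝ → ℝ
  | 0, _ => 1
  | k + 1, x => lam k x * iterLog k x

/-- `Λ(K,x,B) = Λ(K-1,x) + B/λ(K,x)` where `Λ(K,x) = ∑_{k=1}^{K} 1/λ(k,x)`. -/
def LamB (K : ℕ) (B : ℝ) (x : ℝ) : ℝ :=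
  (∑ k ∈ Finset.Icc 1 (K - 1), 1 / lam k x) + B / lam K x

/-- The truncation convention: with `i₀ = min{i ≥ 1 : q i < 1/2}` one has `p i = q i₀`
for `1 ≤ i ≤ i₀` and `p i = q i` for `i > i₀`. -/
def IsTruncation (q p : ℕ → ℝ) : Prop :=
  ∃ i0 : ℕ, 1 ≤ i0 ∧ q i0 < 1 / 2 ∧ (∀ i, 1 ≤ i → i < i0 → ¬ q i < 1 / 2) ∧
    (∀ i, 1 ≤ i → i ≤ i0 → p i = q i0) ∧ ∀ i, i0 < i → p i = q i

end NNRW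

namespace NNRW

variable {p : ℕ → ℝ}

theorem U_pos (hp : ∀ i, 1 ≤ i → 0 ≤ p i ∧ p i < 1 / 2) {i : ℕ} (hi : 1 ≤ i) : 0 < U p i := by
  obtain ⟨h0, h1⟩ := hp i hi
  exact div_pos (by linarith) (by linarith)

theorem E_mem_Icc (hp : ∀ i, 1 ≤ i → 0 ≤ p i ∧ p i < 1 / 2) (i : ℕ) :
    0 ≤ E p i ∧ E p i ≤ 1 := by
  rcases Nat.eq_zero_or_pos i with rfl | hi
  · simp [E]
  · obtain ⟨h0, h1⟩ := hp i hi
    rw [E, if_neg hi.ne']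
    constructor <;> linarith

theorem one_sub_E_eq (hp : ∀ i, 1 ≤ i → 0 ≤ p i ∧ p i < 1 / 2) {i : ℕ} (hi : 1 ≤ i) :
    1 - E p i = E p i * U p i := by
  obtain ⟨h0, h1⟩ := hp i hi
  have : (1 / 2 + p i) ≠ 0 := by linarith
  rw [E, if_neg (by lia), U, mul_div_cancel₀ _ this]
  ring

theorem step_nonneg (hp : ∀ i, 1 ≤ i → 0 ≤ p i ∧ p i < 1 / 2) (i j : ℕ) : 0 ≤ step p i j := by
  obtain ⟨h0, h1⟩ := E_mem_Icc hp i
  unfold step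
  split_ifs <;> linarith

theorem step_add_one (i : ℕ) : step p i (i + 1) = E p i := by simp [step]

theorem step_sub_one (i : ℕ) : step p i (i - 1) = 1 - E p i := by
  rcases i with _ | i
  · simp [step, E]
  · rw [step, if_neg (by lia), if_pos (by lia)]

theorem step_eq_zero {i j : ℕ} (h1 : j ≠ i + 1) (h2 : j ≠ i - 1) : step p i j = 0 := by
  rw [step, if_neg h1, if_neg (by lia)]

/-- The `j`-th term `U (m+1) * ⋯ * U (m+j)` of the series `D(m,∞)`. -/
def tailTerm (p : ℕ → ℝ) (m j : ℕ) : ℝ := ∏ i ∈ Finset.range j, U p (m + 1 + i)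

/-- The sum of the first `n` terms of the series `D(m,∞)`. -/
def tailSum (p : ℕ → ℝ) (m n : ℕ) : ℝ := ∑ j ∈ Finset.range n, tailTerm p m j

theorem tailTerm_pos (hp : ∀ i, 1 ≤ i → 0 ≤ p i ∧ p i < 1 / 2) (m j : ℕ) :
    0 < tailTerm p m j :=
  Finset.prod_pos fun _ _ => U_pos hp (by lia)

theorem tailTerm_succ (m j : ℕ) : tailTerm p m (j + 1) = tailTerm p m j * U p (m + 1 + j) :=
  Finset.prod_range_succ _ _

theorem tailSum_succ (m n : ℕ) : tailSum p m (n + 1) = tailSum p m n + tailTerm p m n :=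
  Finset.sum_range_succ _ _

theorem tailSum_succ' (m n : ℕ) :
    tailSum p m (n + 1) = 1 + U p (m + 1) * tailSum p (m + 1) n := by
  rw [tailSum, Finset.sum_range_succ', tailSum, Finset.mul_sum, add_comm]
  congr 1
  refine Finset.sum_congr rfl fun j _ => ?_
  rw [tailTerm, Finset.prod_range_succ', mul_comm, tailTerm]
  congr 1
  exact Finset.prod_congr rfl fun i _ => by congr 1; ring

theorem Dinf_eq_tsum (m : ℕ) : Dinf p m = ∑' j, ENNReal.ofReal (tailTerm p m j) := by
  rw [tsum_eq_zero_add' ENNReal.summable, Dinf]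
  congr 1
  · simp [tailTerm]
  · refine tsum_congr fun j => ?_
    have : Finset.Icc 1 (j + 1) = Finset.Ico 1 (j + 2) := by ext; simp; lia
    rw [this, Finset.prod_Ico_eq_prod_range, tailTerm]
    congr 1
    exact Finset.prod_congr (by simp) fun i _ => by congr 1; ring

theorem Dinf_toReal (hp : ∀ i, 1 ≤ i → 0 ≤ p i ∧ p i < 1 / 2) {m : ℕ}
    (hs : Summable (tailTerm p m)) : (Dinf p m).toReal = ∑' j, tailTerm p m j := by
  rw [Dinf_eq_tsum, ← ENNReal.ofReal_tsum_of_nonneg (fun j => (tailTerm_pos hp m j).le) hs,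
    ENNReal.toReal_ofReal (tsum_nonneg fun j => (tailTerm_pos hp m j).le)]

/-! ### Bounding path probabilities by space-time superharmonic functions -/

theorem measure_le_of_superharmonic {Ω : Type*} [MeasurableSpace Ω] {P : Measure Ω}
    {X : ℕ → Ω → ℕ} {b : ℕ} (hp : ∀ i, 1 ≤ i → 0 ≤ p i ∧ p i < 1 / 2)
    (hX : IsNNWalk P X p b) (T : ℕ → Set (ℕ → ℕ)) (G : ℕ → ℕ → ℝ) (hG : ∀ n i, 0 ≤ G n i)
    (hzero : ∀ x ∈ T 0, 1 ≤ G 0 (x 0))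
    (hsucc : ∀ n, ∀ x ∈ T (n + 1), 1 ≤ G (n + 1) (x 0) ∨ ((fun j => x (j + 1)) ∈ T n ∧
      E p (x 0) * G n (x 0 + 1) + (1 - E p (x 0)) * G n (x 0 - 1) ≤ G (n + 1) (x 0)))
    (n : ℕ) : ∀ (k : ℕ) (u : ℕ → ℕ), u 0 = b →
      P {ω | (∀ i ≤ k, X i ω = u i) ∧ (fun j => X (k + j) ω) ∈ T n} ≤
        ENNReal.ofReal ((∏ i ∈ Finset.range k, step p (u i) (u (i + 1))) * G n (u k)) := by
  have hW : ∀ k (u : ℕ → ℕ), 0 ≤ ∏ i ∈ Finset.range k, step p (u i) (u (i + 1)) :=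
    fun k u => Finset.prod_nonneg fun i _ => step_nonneg hp _ _
  have hcyl : ∀ n k (u : ℕ → ℕ), u 0 = b → 1 ≤ G n (u k) →
      P {ω | (∀ i ≤ k, X i ω = u i) ∧ (fun j => X (k + j) ω) ∈ T n} ≤
        ENNReal.ofReal ((∏ i ∈ Finset.range k, step p (u i) (u (i + 1))) * G n (u k)) := by
    intro n k u hu h1
    refine (measure_mono fun ω hω => hω.1).trans ((hX.2 k u hu).trans_le ?_)
    exact ENNReal.ofReal_le_ofReal (le_mul_of_one_le_right (hW k u) h1)
  induction n with
  | zero =>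
    intro k u hu
    by_cases h1 : 1 ≤ G 0 (u k)
    · exact hcyl 0 k u hu h1
    · have : {ω | (∀ i ≤ k, X i ω = u i) ∧ (fun j => X (k + j) ω) ∈ T 0} = ∅ := by
        ext ω
        simp only [Set.mem_ofPred_eq, Set.mem_empty_iff_false, iff_false]
        rintro ⟨ha, hb⟩
        exact h1 (by simpa [ha k le_rfl] using hzero _ hb)
      rw [this]
      simp
  | succ n ih =>
    intro k u hu
    by_cases h1 : 1 ≤ G (n + 1) (u k)
    · exact hcyl _ k u hu h1
    by_cases h2 : E p (u k) * G n (u k + 1) + (1 - E p (u k)) * G n (u k - 1) ≤ G (n + 1) (u k)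
    · let v : ℕ → ℕ → ℕ := fun y i => if i ≤ k then u i else y
      have hv : ∀ y, v y (k + 1) = y := fun y => by simp [v]
      have hprod : ∀ y, ∏ i ∈ Finset.range (k + 1), step p (v y i) (v y (i + 1)) =
          (∏ i ∈ Finset.range k, step p (u i) (u (i + 1))) * step p (u k) y := by
        intro y
        rw [Finset.prod_range_succ, hv]
        congr 1
        · refine Finset.prod_congr rfl fun i hi => ?_
          have := Finset.mem_range.1 hi
          simp [v, this.le, Nat.succ_le_of_lt this]
        · simp [v]
      have hsub : {ω | (∀ i ≤ k, X i ω = u i) ∧ (fun j => X (k + j) ω) ∈ T (n + 1)} ⊆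
          ⋃ y, {ω | (∀ i ≤ k + 1, X i ω = v y i) ∧ (fun j => X (k + 1 + j) ω) ∈ T n} := by
        rintro ω ⟨ha, hb⟩
        refine Set.mem_iUnion.2 ⟨X (k + 1) ω, fun i hi => ?_, ?_⟩
        · by_cases hik : i ≤ k
          · simp [v, hik, ha i hik]
          · obtain rfl : i = k + 1 := by lia
            exact (hv _).symm
        · rcases hsucc n _ hb with h | h
          · exact absurd (by simpa [ha k le_rfl] using h) h1
          · convert h.1 using 2
            lia
      have hne : u k + 1 ≠ u k - 1 := by lia
      set W := ∏ i ∈ Finset.range k, step p (u i) (u (i + 1))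
      have hW0 : 0 ≤ W := hW k u
      obtain ⟨hE0, hE1⟩ := E_mem_Icc hp (u k)
      calc _ ≤ ∑' y, P {ω | (∀ i ≤ k + 1, X i ω = v y i) ∧
                (fun j => X (k + 1 + j) ω) ∈ T n} :=
            (measure_mono hsub).trans (measure_iUnion_le _)
        _ ≤ ∑' y, ENNReal.ofReal (W * step p (u k) y * G n y) := by
            refine ENNReal.tsum_le_tsum fun y => ?_
            have := ih (k + 1) (v y) (by simp [v, hu])
            rwa [hprod, hv] at this
        _ = ∑ y ∈ {u k + 1, u k - 1}, ENNReal.ofReal (W * step p (u k) y * G n y) := by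
            refine tsum_eq_sum fun y hy => ?_
            simp only [Finset.mem_insert, Finset.mem_singleton, not_or] at hy
            simp [step_eq_zero hy.1 hy.2]
        _ = ENNReal.ofReal (W * (E p (u k) * G n (u k + 1) +
              (1 - E p (u k)) * G n (u k - 1))) := by
            rw [Finset.sum_pair hne, step_add_one, step_sub_one, ← ENNReal.ofReal_add]
            · congr 1; ring
            · exact mul_nonneg (mul_nonneg hW0 hE0) (hG _ _)
            · exact mul_nonneg (mul_nonneg hW0 (by linarith)) (hG _ _)
        _ ≤ _ := ENNReal.ofReal_le_ofReal (mul_le_mul_of_nonneg_left h2 hW0)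
    · have : {ω | (∀ i ≤ k, X i ω = u i) ∧ (fun j => X (k + j) ω) ∈ T (n + 1)} = ∅ := by
        ext ω
        simp only [Set.mem_ofPred_eq, Set.mem_empty_iff_false, iff_false]
        rintro ⟨ha, hb⟩
        have := hsucc n _ hb
        simp only [add_zero, ha k le_rfl] at this
        tauto
      rw [this]
      simp

/-! ### Hitting probabilities -/

/-- The probability that the walk started at `b` visits `m` within the first `n` steps. -/
def hitProb (p : ℕ → ℝ) (m : ℕ) : ℕ → ℕ → ℝ
  | 0, b => if b = m then 1 else 0
  | n + 1, b => if b = m then 1 else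
      E p b * hitProb p m n (b + 1) + (1 - E p b) * hitProb p m n (b - 1)

theorem hitProb_self (m n : ℕ) : hitProb p m n m = 1 := by
  cases n <;> simp [hitProb]

theorem hitProb_succ {m b : ℕ} (h : b ≠ m) (n : ℕ) : hitProb p m (n + 1) b =
    E p b * hitProb p m n (b + 1) + (1 - E p b) * hitProb p m n (b - 1) := by
  rw [hitProb, if_neg h]

theorem hitProb_nonneg (hp : ∀ i, 1 ≤ i → 0 ≤ p i ∧ p i < 1 / 2) (m n b : ℕ) :
    0 ≤ hitProb p m n b := by
  induction n generalizing b with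
  | zero => unfold hitProb; split_ifs <;> norm_num
  | succ n ih =>
    obtain ⟨h0, h1⟩ := E_mem_Icc hp b
    unfold hitProb
    split_ifs
    · norm_num
    · exact add_nonneg (mul_nonneg h0 (ih _)) (mul_nonneg (by linarith) (ih _))

theorem hitProb_le_of_superharmonic (hp : ∀ i, 1 ≤ i → 0 ≤ p i ∧ p i < 1 / 2) {m : ℕ}
    {f : ℕ → ℝ} (hf0 : ∀ b, 0 ≤ f b) (hfm : 1 ≤ f m)
    (hf : ∀ b, b ≠ m → E p b * f (b + 1) + (1 - E p b) * f (b - 1) ≤ f b) (n b : ℕ) :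
    hitProb p m n b ≤ f b := by
  induction n generalizing b with
  | zero =>
    unfold hitProb
    split_ifs with h
    · exact h ▸ hfm
    · exact hf0 b
  | succ n ih =>
    obtain ⟨h0, h1⟩ := E_mem_Icc hp b
    by_cases h : b = m
    · rw [h, hitProb_self]; exact hfm
    · rw [hitProb_succ h]
      exact (add_le_add (mul_le_mul_of_nonneg_left (ih _) h0)
        (mul_le_mul_of_nonneg_left (ih _) (by linarith))).trans (hf b h)

theorem hitProb_le_one (hp : ∀ i, 1 ≤ i → 0 ≤ p i ∧ p i < 1 / 2) (m n b : ℕ) :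
    hitProb p m n b ≤ 1 :=
  hitProb_le_of_superharmonic hp (f := fun _ => 1) (fun _ => zero_le_one) le_rfl
    (fun b _ => by simp) n b

theorem hitProb_mono (hp : ∀ i, 1 ≤ i → 0 ≤ p i ∧ p i < 1 / 2) (m b : ℕ) :
    Monotone fun n => hitProb p m n b := by
  refine monotone_nat_of_le_succ fun n => ?_
  induction n generalizing b with
  | zero =>
    by_cases h : b = m
    · rw [h, hitProb_self, hitProb_self]
    · rw [hitProb, if_neg h]
      exact hitProb_nonneg hp _ _ _
  | succ n ih =>
    obtain ⟨h0, h1⟩ := E_mem_Icc hp b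
    by_cases h : b = m
    · rw [h, hitProb_self, hitProb_self]
    · rw [hitProb_succ h, hitProb_succ h]
      exact add_le_add (mul_le_mul_of_nonneg_left (ih _) h0)
        (mul_le_mul_of_nonneg_left (ih _) (by linarith))

theorem measure_hit_within {Ω : Type*} [MeasurableSpace Ω] {P : Measure Ω}
    [IsProbabilityMeasure P] {X : ℕ → Ω → ℕ} {b : ℕ}
    (hp : ∀ i, 1 ≤ i → 0 ≤ p i ∧ p i < 1 / 2) (hX : IsNNWalk P X p b) (m n : ℕ) :
    P {ω | ∃ j ≤ n, X j ω = m} = ENNReal.ofReal (hitProb p m n b) := by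
  have hle : P {ω | ∃ j ≤ n, X j ω = m} ≤ ENNReal.ofReal (hitProb p m n b) := by
    have := measure_le_of_superharmonic hp hX (fun n => {x | ∃ j ≤ n, x j = m}) (hitProb p m)
      (hitProb_nonneg hp m) ?_ ?_ n 0 (fun _ => b) rfl
    · simpa [hX.1] using this
    · rintro x ⟨j, hj, hxj⟩
      obtain rfl : j = 0 := by lia
      rw [hxj, hitProb_self]
    · rintro n x ⟨j, hj, hxj⟩
      by_cases h : x 0 = m
      · left; rw [h, hitProb_self]
      · right
        refine ⟨?_, (hitProb_succ h n).ge⟩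
        rcases j with _ | j
        · exact absurd hxj h
        · exact ⟨j, by lia, hxj⟩
  have hge : P {ω | ∀ j ≤ n, X j ω ≠ m} ≤ ENNReal.ofReal (1 - hitProb p m n b) := by
    have := measure_le_of_superharmonic hp hX (fun n => {x | ∀ j ≤ n, x j ≠ m})
      (fun n i => 1 - hitProb p m n i) (fun n i => by linarith [hitProb_le_one hp m n i])
      ?_ ?_ n 0 (fun _ => b) rfl
    · simpa [hX.1] using this
    · intro x hx
      simp [hitProb, hx 0 le_rfl]
    · intro n x hx
      right
      refine ⟨fun j hj => hx (j + 1) (by lia), ?_⟩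
      rw [hitProb_succ (hx 0 (by lia))]
      linarith
  refine le_antisymm hle ?_
  have hcover : (1 : ℝ≥0∞) ≤ P {ω | ∃ j ≤ n, X j ω = m} + P {ω | ∀ j ≤ n, X j ω ≠ m} := by
    rw [← measure_univ (μ := P)]
    refine (measure_mono fun ω _ => ?_).trans (measure_union_le _ _)
    by_cases h : ∃ j ≤ n, X j ω = m
    · exact Or.inl h
    · right
      intro j hj hj'
      exact h ⟨j, hj, hj'⟩
  have hsum : ENNReal.ofReal (hitProb p m n b) + ENNReal.ofReal (1 - hitProb p m n b) = 1 := by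
    rw [← ENNReal.ofReal_add (hitProb_nonneg hp m n b)
      (by linarith [hitProb_le_one hp m n b])]
    simp
  have := hsum.le.trans (hcover.trans (add_le_add_right hge _))
  exact (ENNReal.add_le_add_iff_right ENNReal.ofReal_ne_top).1 this

theorem tendsto_hitProb_measure_hits {Ω : Type*} [MeasurableSpace Ω] {P : Measure Ω}
    [IsProbabilityMeasure P] {X : ℕ → Ω → ℕ} {b : ℕ}
    (hp : ∀ i, 1 ≤ i → 0 ≤ p i ∧ p i < 1 / 2) (hX : IsNNWalk P X p b) (m : ℕ) :
    Tendsto (fun n => hitProb p m n b) atTop (𝓝 (P (hits X m)).toReal) := by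
  have hU : hits X m = ⋃ n, {ω | ∃ j ≤ n, X j ω = m} := by
    ext ω
    simp only [hits, Set.mem_ofPred_eq, Set.mem_iUnion]
    exact ⟨fun ⟨n, h⟩ => ⟨n, n, le_rfl, h⟩, fun ⟨_, j, _, h⟩ => ⟨j, h⟩⟩
  have hmono : Monotone fun n => {ω | ∃ j ≤ n, X j ω = m} :=
    fun a c hac ω ⟨j, hj, h⟩ => ⟨j, hj.trans hac, h⟩
  have := (ENNReal.tendsto_toReal (measure_ne_top P _)).comp
    (tendsto_measure_iUnion_atTop (μ := P) hmono)
  rw [← hU] at this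
  refine this.congr fun n => ?_
  simp only [Function.comp_apply]
  rw [measure_hit_within hp hX, ENNReal.toReal_ofReal (hitProb_nonneg hp m n b)]

theorem tendsto_hitProb (hp : ∀ i, 1 ≤ i → 0 ≤ p i ∧ p i < 1 / 2) {m : ℕ}
    (hs : Summable (tailTerm p m)) :
    Tendsto (fun n => hitProb p m n (m + 1)) atTop (𝓝 (1 - 1 / ∑' j, tailTerm p m j)) := by
  set D := ∑' j, tailTerm p m j
  have hSD : ∀ n, tailSum p m n ≤ D := fun n =>
    hs.sum_le_tsum _ fun j _ => (tailTerm_pos hp m j).le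
  have hSlim : Tendsto (tailSum p m) atTop (𝓝 D) := hs.hasSum.tendsto_sum_nat
  have hD0 : 0 < D := lt_of_lt_of_le (by simp [tailSum, tailTerm]) (hSD 1)
  have hbound : ∀ n b, hitProb p m n b ≤ 1 - tailSum p m (b - m) / D := by
    refine hitProb_le_of_superharmonic hp (fun b => ?_) (by simp [tailSum]) fun b hb => ?_
    · rw [sub_nonneg, div_le_one hD0]
      exact hSD _
    · rcases lt_or_gt_of_ne hb with hlt | hgt
      · rw [show b + 1 - m = 0 by lia, show b - 1 - m = 0 by lia, show b - m = 0 by lia]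
        simp [tailSum]
      · obtain ⟨k, rfl⟩ : ∃ k, b = m + 1 + k := ⟨b - (m + 1), by lia⟩
        rw [show m + 1 + k + 1 - m = k + 1 + 1 by lia, show m + 1 + k - 1 - m = k by lia,
          show m + 1 + k - m = k + 1 by lia, tailSum_succ _ (k + 1), tailSum_succ _ k,
          tailTerm_succ]
        have := one_sub_E_eq hp (i := m + 1 + k) (by lia)
        rw [this]
        refine le_of_eq ?_
        have hE : E p (m + 1 + k) * U p (m + 1 + k) = 1 - E p (m + 1 + k) := this.symm
        field_simp
        linear_combination (D - tailSum p m k - tailTerm p m k) * hE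
  have hlim : ∀ b, ∃ g, Tendsto (fun n => hitProb p m n b) atTop (𝓝 g) := fun b =>
    ⟨_, tendsto_atTop_ciSup (hitProb_mono hp m b)
      ⟨1, by rintro _ ⟨n, rfl⟩; exact hitProb_le_one hp m n b⟩⟩
  choose g hg using hlim
  have hgm : g m = 1 := tendsto_nhds_unique (hg m) (by simp [hitProb_self])
  have hharm : ∀ b, b ≠ m → g b = E p b * g (b + 1) + (1 - E p b) * g (b - 1) := by
    intro b hb
    refine tendsto_nhds_unique ((hg b).comp (tendsto_add_atTop_nat 1)) ?_
    refine (((hg (b + 1)).const_mul _).add ((hg (b - 1)).const_mul _)).congr fun n => ?_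
    exact (hitProb_succ hb n).symm
  have hincr : ∀ k, g (m + k + 1) - g (m + k) = (g (m + 1) - 1) * tailTerm p m k := by
    intro k
    induction k with
    | zero => simp [tailTerm, hgm]
    | succ k ih =>
      have h1 := hharm (m + k + 1) (by lia)
      have h2 := one_sub_E_eq hp (i := m + k + 1) (by lia)
      have h3 : 0 < E p (m + k + 1) := by
        have := (hp (m + k + 1) (by lia)).1
        rw [E, if_neg (by lia)]
        linarith
      rw [Nat.add_sub_cancel] at h1
      rw [tailTerm_succ, ← mul_assoc, ← ih, show m + 1 + k = m + k + 1 by ring,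
        show m + (k + 1) = m + k + 1 by ring]
      apply mul_left_cancel₀ h3.ne'
      linear_combination -h1 + (g (m + k + 1) - g (m + k)) * h2
  have hsol : ∀ k, g (m + k) = 1 + (g (m + 1) - 1) * tailSum p m k := by
    intro k
    induction k with
    | zero => simp [tailSum, hgm]
    | succ k ih =>
      rw [tailSum_succ, ← add_assoc]
      linear_combination ih + hincr k
  have hg0 : Tendsto (fun k => g (m + k)) atTop (𝓝 0) := by
    have hup : Tendsto (fun k => 1 - tailSum p m k / D) atTop (𝓝 0) := by
      have := (hSlim.div_const D).const_sub 1
      rwa [div_self hD0.ne', sub_self] at this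
    refine squeeze_zero (fun k => ge_of_tendsto' (hg _) fun n => hitProb_nonneg hp m n _)
      (fun k => le_of_tendsto' (hg _) fun n => ?_) hup
    simpa using hbound n (m + k)
  have hg1 : Tendsto (fun k => g (m + k)) atTop (𝓝 (1 + (g (m + 1) - 1) * D)) := by
    rw [funext hsol]
    exact (hSlim.const_mul _).const_add 1
  have hfin := tendsto_nhds_unique hg0 hg1
  have : g (m + 1) = 1 - 1 / D := by
    field_simp
    linarith
  exact this ▸ hg (m + 1)

/-! ### Asymptotics of `D(m,∞)` -/

theorem tailSum_le_of_supersolution (hp : ∀ i, 1 ≤ i → 0 ≤ p i ∧ p i < 1 / 2) {V : ℕ → ℝ}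
    {M : ℕ} (hV0 : ∀ m, 0 ≤ V m) (hV : ∀ m ≥ M, 1 + U p (m + 1) * V (m + 1) ≤ V m) (n : ℕ) :
    ∀ m ≥ M, tailSum p m n ≤ V m := by
  induction n with
  | zero => intro m _; simpa [tailSum] using hV0 m
  | succ n ih =>
    intro m hm
    rw [tailSum_succ']
    have := mul_le_mul_of_nonneg_left (ih (m + 1) (by lia)) (U_pos hp (i := m + 1) (by lia)).le
    linarith [hV m hm]

theorem U_antitone (hp : ∀ i, 1 ≤ i → 0 ≤ p i ∧ p i < 1 / 2) {i j : ℕ} (hi : 1 ≤ i)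
    (hj : 1 ≤ j) (h : p j ≤ p i) : U p i ≤ U p j := by
  obtain ⟨h0, h1⟩ := hp i hi
  obtain ⟨h2, h3⟩ := hp j hj
  unfold U
  gcongr

theorem le_tsum_tailTerm (hp : ∀ i, 1 ≤ i → 0 ≤ p i ∧ p i < 1 / 2) {m : ℕ}
    (hs : Summable (tailTerm p m)) (hpos : 0 < p (m + 1))
    (hanti : ∀ i, p (m + 1 + i) ≤ p (m + 1)) :
    1 / (4 * p (m + 1)) ≤ ∑' j, tailTerm p m j := by
  have hU0 := U_pos hp (i := m + 1) (by lia)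
  have h1U : 1 - U p (m + 1) = 2 * p (m + 1) / (1 / 2 + p (m + 1)) := by
    unfold U
    field_simp
    ring
  have hU1 : U p (m + 1) < 1 := by
    have : 0 < 1 - U p (m + 1) := h1U ▸ by positivity
    linarith
  calc 1 / (4 * p (m + 1)) ≤ (1 - U p (m + 1))⁻¹ := by
        rw [h1U, inv_div, div_le_div_iff₀ (by positivity) (by positivity)]
        nlinarith
    _ = ∑' j, U p (m + 1) ^ j := (tsum_geometric_of_lt_one hU0.le hU1).symm
    _ ≤ _ := by
        refine (summable_geometric_of_lt_one hU0.le hU1).tsum_le_tsum (fun j => ?_) hs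
        simpa [tailTerm] using Finset.prod_le_prod (s := Finset.range j) (f := fun _ => U p (m + 1))
          (fun _ _ => hU0.le) fun i _ => U_antitone hp (by lia) (by lia) (hanti i)

theorem U_le (hp : ∀ i, 1 ≤ i → 0 ≤ p i ∧ p i < 1 / 2) {i : ℕ} (hi : 1 ≤ i) :
    U p i ≤ 1 - 4 * p i + 8 * p i ^ 2 := by
  obtain ⟨h0, h1⟩ := hp i hi
  rw [U, div_le_iff₀ (by linarith)]
  nlinarith [pow_nonneg h0 3]

theorem tendsto_rpow_succ_sub_rpow {α : ℝ} (hα0 : 0 < α) (hα1 : α < 1) :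
    Tendsto (fun m : ℕ => ((m + 1 : ℕ) : ℝ) ^ α - (m : ℝ) ^ α) atTop (𝓝 0) := by
  have hlim : Tendsto (fun m : ℕ => α * (m : ℝ) ^ (-(1 - α))) atTop (𝓝 0) := by
    simpa using ((tendsto_rpow_neg_atTop (sub_pos.2 hα1)).comp
      tendsto_natCast_atTop_atTop).const_mul α
  refine squeeze_zero' (Eventually.of_forall fun m => ?_) ?_ hlim
  · rw [sub_nonneg]
    exact Real.rpow_le_rpow (by positivity) (by simp) hα0.le
  · filter_upwards [eventually_gt_atTop 0] with m hm
    have hm' : (0 : ℝ) < m := by exact_mod_cast hm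
    have h1 : ((m + 1 : ℕ) : ℝ) = m * (1 + 1 / m) := by
      push_cast
      field_simp
    have hb := rpow_one_add_le_one_add_mul_self (s := 1 / (m : ℝ))
      (by linarith [one_div_pos.2 hm']) hα0.le hα1.le
    have h2 : (m : ℝ) ^ (-(1 - α)) = (m : ℝ) ^ α * (1 / m) := by
      rw [neg_sub, Real.rpow_sub_one hm'.ne', mul_one_div]
    rw [h1, Real.mul_rpow hm'.le (by positivity), h2]
    nlinarith [mul_le_mul_of_nonneg_left hb (Real.rpow_nonneg hm'.le α)]

theorem eventually_tailSum_le {B α : ℝ} (hB : 0 < B) (hα0 : 0 < α) (hα1 : α < 1)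
    (hp : ∀ i, 1 ≤ i → 0 ≤ p i ∧ p i < 1 / 2)
    (hpB : ∀ᶠ i : ℕ in atTop, p i = B / (4 * (i : ℝ) ^ α)) {ε : ℝ} (hε : 0 < ε) :
    ∀ᶠ m : ℕ in atTop, ∀ n, tailSum p m n ≤ (1 + ε) * (m : ℝ) ^ α / B := by
  have hsucc : Tendsto (fun m : ℕ => m + 1) atTop atTop := tendsto_add_atTop_nat 1
  have hp0 : Tendsto (fun m : ℕ => p (m + 1)) atTop (𝓝 0) := by
    have h1 : Tendsto (fun i : ℕ => B / (4 * (i : ℝ) ^ α)) atTop (𝓝 0) :=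
      (((tendsto_rpow_atTop hα0).comp tendsto_natCast_atTop_atTop).const_mul_atTop
        (by norm_num : (0 : ℝ) < 4)).const_div_atTop B
    exact (h1.congr' (hpB.mono fun i hi => hi.symm)).comp hsucc
  have hlim : Tendsto (fun m : ℕ => (1 + ε) * (1 - 2 * p (m + 1) -
      (((m + 1 : ℕ) : ℝ) ^ α - (m : ℝ) ^ α) / B)) atTop (𝓝 (1 + ε)) := by
    simpa using (((hp0.const_mul 2).const_sub 1).sub
      ((tendsto_rpow_succ_sub_rpow hα0 hα1).div_const B)).const_mul (1 + ε)
  obtain ⟨M, hM⟩ := eventually_atTop.1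
    ((hlim.eventually_const_lt (by linarith : (1 : ℝ) < 1 + ε)).and (hsucc.eventually hpB))
  filter_upwards [eventually_ge_atTop M] with m hm n
  refine tailSum_le_of_supersolution hp (V := fun m : ℕ => (1 + ε) * (m : ℝ) ^ α / B)
    (fun m => by positivity) (fun m hm => ?_) n m hm
  obtain ⟨h1, h2⟩ := hM m hm
  have hy : 0 < ((m + 1 : ℕ) : ℝ) ^ α := by positivity
  set y := ((m + 1 : ℕ) : ℝ) ^ α
  set q := p (m + 1)
  have hyq : y / B * q = 1 / 4 := by
    rw [h2]
    field_simp
  have hU := mul_le_mul_of_nonneg_right (U_le hp (i := m + 1) (by lia))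
    (by positivity : 0 ≤ (1 + ε) * (y / B))
  have hexp : (1 - 4 * q + 8 * q ^ 2) * ((1 + ε) * (y / B)) =
      (1 + ε) * (y / B - 1 + 2 * q) := by
    linear_combination ((1 + ε) * (-4 + 8 * q)) * hyq
  have hU' : U p (m + 1) * ((1 + ε) * y / B) ≤ (1 + ε) * (y / B - 1 + 2 * q) := by
    rw [← hexp, mul_div_assoc]
    exact hU
  have hV : (1 + ε) * (m : ℝ) ^ α / B =
      (1 + ε) * (1 - 2 * q - (y - (m : ℝ) ^ α) / B) + (1 + ε) * (y / B - 1 + 2 * q) := by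
    ring
  rw [hV]
  linarith

theorem eventually_summable_tailTerm {B α : ℝ} (hB : 0 < B) (hα0 : 0 < α) (hα1 : α < 1)
    (hp : ∀ i, 1 ≤ i → 0 ≤ p i ∧ p i < 1 / 2)
    (hpB : ∀ᶠ i : ℕ in atTop, p i = B / (4 * (i : ℝ) ^ α)) :
    ∀ᶠ m : ℕ in atTop, Summable (tailTerm p m) :=
  (eventually_tailSum_le hB hα0 hα1 hp hpB one_pos).mono fun m hm =>
    summable_of_sum_range_le (fun j => (tailTerm_pos hp m j).le) hm

theorem tendsto_Dinf {B α : ℝ} (hB : 0 < B) (hα0 : 0 < α) (hα1 : α < 1)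
    (hp : ∀ i, 1 ≤ i → 0 ≤ p i ∧ p i < 1 / 2)
    (hpB : ∀ᶠ i : ℕ in atTop, p i = B / (4 * (i : ℝ) ^ α)) :
    Tendsto (fun m : ℕ => (Dinf p m).toReal * B / (m : ℝ) ^ α) atTop (𝓝 1) := by
  have hsum := eventually_summable_tailTerm hB hα0 hα1 hp hpB
  refine tendsto_order.2 ⟨fun a ha => ?_, fun a ha => ?_⟩
  · obtain ⟨M, hM⟩ := eventually_atTop.1 hpB
    filter_upwards [hsum, eventually_ge_atTop M, eventually_gt_atTop 0] with m hs hm hm0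
    have hm' : (0 : ℝ) < m := by exact_mod_cast hm0
    have hx : 0 < (m : ℝ) ^ α := by positivity
    have h1 := hM (m + 1) (by lia)
    have hle := le_tsum_tailTerm hp hs (by rw [h1]; positivity) fun i => by
      rw [h1, hM (m + 1 + i) (by lia)]
      gcongr B / (4 * ?_ ^ α)
      exact_mod_cast Nat.le_add_right _ _
    have hinv : 1 / (4 * p (m + 1)) = ((m + 1 : ℕ) : ℝ) ^ α / B := by
      rw [h1]
      field_simp
    have hmono : (m : ℝ) ^ α ≤ ((m + 1 : ℕ) : ℝ) ^ α :=
      Real.rpow_le_rpow hm'.le (by simp) hα0.le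
    rw [hinv, div_le_iff₀ hB] at hle
    refine ha.trans_le ?_
    rw [Dinf_toReal hp hs, one_le_div hx]
    exact hmono.trans hle
  · filter_upwards [hsum, eventually_gt_atTop 0, eventually_tailSum_le hB hα0 hα1 hp hpB
      (half_pos (sub_pos.2 ha))] with m hs hm0 hle
    have hm' : (0 : ℝ) < m := by exact_mod_cast hm0
    have hx : 0 < (m : ℝ) ^ α := by positivity
    have h := Real.tsum_le_of_sum_range_le (fun j => (tailTerm_pos hp m j).le) hle
    rw [le_div_iff₀ hB] at h
    rw [Dinf_toReal hp hs, div_lt_iff₀ hx]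
    nlinarith

end NNRW

open NNRW
/-- for `p_i = B/(4 i^α)` (truncation convention), `0 < α < 1`,
`D(m,∞) = (1+o(1)) m^α/B` and `1 - p(m,m+1,∞) = (1+o(1)) B/m^α`. -/
theorem stmt6 (B α : ℝ) (hB : 0 < B) (hα0 : 0 < α) (hα1 : α < 1) (p : ℕ → ℝ)
    (hp : ∀ i, 1 ≤ i → 0 ≤ p i ∧ p i < 1 / 2)
    (htr : IsTruncation (fun i : ℕ => B / (4 * (i : ℝ) ^ α)) p)
    (Ω : ℕ → Type) [∀ m, MeasurableSpace (Ω m)] (P : ∀ m, Measure (Ω m))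
    [∀ m, IsProbabilityMeasure (P m)] (X : ∀ m, ℕ → Ω m → ℕ)
    (hX : ∀ m : ℕ, IsNNWalk (P m) (X m) p (m + 1)) :
    Tendsto (fun m : ℕ => (Dinf p m).toReal * B / (m : ℝ) ^ α) atTop (𝓝 1) ∧
      Tendsto (fun m : ℕ => (1 - (P m (hits (X m) m)).toReal) * (m : ℝ) ^ α / B)
        atTop (𝓝 1) := by
  have hpB : ∀ᶠ i : ℕ in atTop, p i = B / (4 * (i : ℝ) ^ α) := by
    obtain ⟨i0, -, -, -, -, h⟩ := htr
    filter_upwards [eventually_gt_atTop i0] with i hi using h i hi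
  have hD := tendsto_Dinf hB hα0 hα1 hp hpB
  refine ⟨hD, ?_⟩
  have hinv := hD.inv₀ one_ne_zero
  rw [inv_one] at hinv
  refine hinv.congr' ?_
  filter_upwards [eventually_summable_tailTerm hB hα0 hα1 hp hpB] with m hs
  rw [tendsto_nhds_unique (tendsto_hitProb_measure_hits hp (hX m) m) (tendsto_hitProb hp hs),
    Dinf_toReal hp hs, inv_div, sub_sub_cancel, one_div_mul_eq_div, div_div]
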